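/- For every compact connected set K ⊂ ℝ² with H¹(K) < ∞, there exists a Lipschitz closed curve γ : ℝ/ℤ → ℝ² with image γ(ℝ/ℤ) = K, winding number ω(γ, x) = 0 for all x ∉ K, and length ℓ(γ) = 2 H¹(K). -/

import Mathlib

open MeasureTheory Set

/-- Winding number of a closed curve (1-periodic map ℝ → ℂ) around a point. -/
noncomputable def winding (γ : ℝ → ℂ) (x : ℂ) : ℂ :=
  (2 * Real.pi * Complex.I)⁻¹ * ∫ t in (0:ℝ)..1, deriv γ t / (γ t - x)

open Filter Topology
open scoped NNReal ENNReal

/-! ### Calculus of Lipschitz curves -/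

lemma LipschitzWith.intervalIntegrable_deriv {f : ℝ → ℂ} {C : ℝ≥0} (hf : LipschitzWith C f)
    (a b : ℝ) : IntervalIntegrable (deriv f) volume a b := by
  refine (intervalIntegrable_const (c := (C : ℝ))).mono_fun
    (measurable_deriv f).aestronglyMeasurable (ae_of_all _ fun t => ?_)
  simpa using norm_deriv_le_of_lipschitz (𝕜 := ℝ) hf (x₀ := t)

lemma LipschitzOnWith.integral_eq_sub {f f' : ℝ → ℂ} {C : ℝ≥0} {a b : ℝ}
    (hf : LipschitzOnWith C f (uIcc a b)) (hi : IntervalIntegrable f' volume a b)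
    (hd : ∀ᵐ t, t ∈ uIoc a b → HasDerivAt f (f' t) t) :
    ∫ t in a..b, f' t = f b - f a := by
  have hre : LipschitzOnWith C (fun t => (f t).re) (uIcc a b) :=
    LipschitzOnWith.of_dist_le_mul fun s hs t ht => by
      refine le_trans ?_ (hf.dist_le_mul s hs t ht)
      simpa [Complex.dist_eq, Real.dist_eq] using Complex.abs_re_le_norm (f s - f t)
  have him : LipschitzOnWith C (fun t => (f t).im) (uIcc a b) :=
    LipschitzOnWith.of_dist_le_mul fun s hs t ht => by
      refine le_trans ?_ (hf.dist_le_mul s hs t ht)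
      simpa [Complex.dist_eq, Real.dist_eq] using Complex.abs_im_le_norm (f s - f t)
  have h1 := hre.absolutelyContinuousOnInterval.integral_deriv_eq_sub
  have h2 := him.absolutelyContinuousOnInterval.integral_deriv_eq_sub
  have e1 : ∫ t in a..b, deriv (fun t => (f t).re) t = ∫ t in a..b, (f' t).re := by
    refine intervalIntegral.integral_congr_ae (hd.mono fun t ht htm => ?_)
    exact (Complex.reCLM.hasFDerivAt.comp_hasDerivAt t (ht htm)).deriv
  have e2 : ∫ t in a..b, deriv (fun t => (f t).im) t = ∫ t in a..b, (f' t).im := by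
    refine intervalIntegral.integral_congr_ae (hd.mono fun t ht htm => ?_)
    exact (Complex.imCLM.hasFDerivAt.comp_hasDerivAt t (ht htm)).deriv
  have e3 : ∫ t in a..b, (f' t).re = (∫ t in a..b, f' t).re :=
    Complex.reCLM.intervalIntegral_comp_comm hi
  have e4 : ∫ t in a..b, (f' t).im = (∫ t in a..b, f' t).im :=
    Complex.imCLM.intervalIntegral_comp_comm hi
  apply Complex.ext
  · rw [← e3, ← e1, h1, Complex.sub_re]
  · rw [← e4, ← e2, h2, Complex.sub_im]

lemma LipschitzWith.ae_hasDerivAt {f : ℝ → ℂ} {C : ℝ≥0} (hf : LipschitzWith C f) :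
    ∀ᵐ t, HasDerivAt f (deriv f t) t :=
  hf.ae_differentiableAt_real.mono fun _ ht => ht.hasDerivAt

lemma LipschitzWith.integral_deriv_eq_sub {f : ℝ → ℂ} {C : ℝ≥0} (hf : LipschitzWith C f)
    (a b : ℝ) : ∫ t in a..b, deriv f t = f b - f a :=
  hf.lipschitzOnWith.integral_eq_sub (hf.intervalIntegrable_deriv a b)
    (hf.ae_hasDerivAt.mono fun _ ht _ => ht)

lemma LipschitzWith.eVariationOn_Icc_le_integral {f : ℝ → ℂ} {C : ℝ≥0} (hf : LipschitzWith C f)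
    (a b : ℝ) :
    eVariationOn f (Icc a b) ≤ ENNReal.ofReal (∫ t in a..b, ‖deriv f t‖) := by
  have hint : ∀ c d, IntervalIntegrable (fun t => ‖deriv f t‖) volume c d := fun c d =>
    (hf.intervalIntegrable_deriv c d).norm
  refine iSup_le fun ⟨n, u, hu, hmem⟩ => ?_
  calc ∑ i ∈ Finset.range n, edist (f (u (i + 1))) (f (u i))
      ≤ ∑ i ∈ Finset.range n, ENNReal.ofReal (∫ t in u i..u (i + 1), ‖deriv f t‖) := by
        gcongr with i
        rw [edist_dist, dist_eq_norm, ← hf.integral_deriv_eq_sub]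
        exact ENNReal.ofReal_le_ofReal
          (intervalIntegral.norm_integral_le_integral_norm (hu (Nat.le_succ i)))
    _ = ENNReal.ofReal (∫ t in u 0..u n, ‖deriv f t‖) := by
        rw [← ENNReal.ofReal_sum_of_nonneg, intervalIntegral.sum_integral_adjacent_intervals]
        · exact fun k _ => hint _ _
        · exact fun i _ => intervalIntegral.integral_nonneg (hu (Nat.le_succ i))
            fun t _ => norm_nonneg _
    _ ≤ _ := ENNReal.ofReal_le_ofReal <| by
        refine intervalIntegral.integral_mono_interval (hmem 0).1 (hu (Nat.zero_le n)) (hmem n).2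
          (ae_of_all _ fun t => norm_nonneg _) (hint _ _)

/-- The one-dimensional Hausdorff measure of a Lipschitz curve is at most its length. -/
lemma LipschitzWith.hausdorffMeasure_image_Icc_le_eVariationOn {f : ℝ → ℂ}
    (hf : LipschitzWith 1 f) {l : ℝ} (hl : 0 ≤ l) :
    Measure.hausdorffMeasure 1 (f '' Icc 0 l) ≤ eVariationOn f (Icc 0 l) := by
  let I : ℕ → ℕ → ℝ := fun n i => l * i / (n + 1)
  have hI : ∀ n, Monotone (I n) := fun n i j hij => by
    simp only [I]; gcongr
  have hlim : Tendsto (fun n : ℕ => ENNReal.ofReal (l / (n + 1))) atTop (𝓝 0) := by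
    have := ENNReal.tendsto_ofReal
      ((tendsto_const_div_atTop_nhds_zero_nat l).comp (tendsto_add_atTop_nat 1))
    simpa using this
  refine (Measure.hausdorffMeasure_le_liminf_sum (ι := fun n : ℕ => Fin (n + 1)) 1 _ _ hlim
    (fun n i => f '' Icc (I n i) (I n (i + 1))) (.of_forall fun n i => ?_)
    (.of_forall fun n => ?_)).trans ?_
  · refine (hf.ediam_image_le _).trans ?_
    rw [Real.ediam_Icc, ENNReal.coe_one, one_mul]
    refine ENNReal.ofReal_le_ofReal (le_of_eq ?_)
    simp only [I]; push_cast; field_simp; ring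
  · rw [← image_iUnion]
    refine image_mono fun t ht => ?_
    rcases hl.eq_or_lt with rfl | hl'
    · simp only [mem_iUnion]
      exact ⟨0, by simpa [I] using ht⟩
    simp only [mem_iUnion]
    rcases ht.2.eq_or_lt with rfl | htl
    · refine ⟨Fin.last n, ?_, ?_⟩
      · simp only [I, Fin.val_last]
        rw [div_le_iff₀ (by positivity)]; nlinarith
      · simp only [I, Fin.val_last]
        rw [le_div_iff₀ (by positivity)]; push_cast; nlinarith
    · have h0 : 0 ≤ t * (n + 1) / l := by have := ht.1; positivity
      refine ⟨⟨⌊t * (n + 1) / l⌋₊, ?_⟩, ?_, ?_⟩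
      · rw [Nat.floor_lt h0, div_lt_iff₀ hl']; push_cast; nlinarith
      · have := Nat.floor_le h0
        simp only [I]
        rw [div_le_iff₀ (by positivity)]
        rw [le_div_iff₀ hl'] at this; linarith
      · have := (Nat.lt_floor_add_one (t * (n + 1) / l)).le
        simp only [I]
        rw [le_div_iff₀ (by positivity)]
        rw [div_le_iff₀ hl'] at this; push_cast; linarith
  · refine liminf_le_of_le (by isBoundedDefault) fun b hb => ?_
    obtain ⟨n, hn⟩ := hb.exists
    refine hn.trans ?_
    calc ∑ i : Fin (n + 1), Metric.ediam (f '' Icc (I n i) (I n (i + 1))) ^ (1 : ℝ)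
        ≤ ∑ i : Fin (n + 1), eVariationOn f (Icc (I n i) (I n (i + 1))) := by
          gcongr with i
          rw [ENNReal.rpow_one]
          refine Metric.ediam_le ?_
          rintro _ ⟨s, hs, rfl⟩ _ ⟨t, ht, rfl⟩
          exact eVariationOn.edist_le f hs ht
      _ = eVariationOn f (Icc (I n 0) (I n (n + 1 : ℕ))) := by
          rw [← eVariationOn.sum' f (hI n),
            Finset.sum_range fun i => eVariationOn f (Icc (I n i) (I n (i + 1)))]
      _ = eVariationOn f (Icc 0 l) := by
          congr 2
          · simp [I]
          · simp only [I]; push_cast; field_simp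
      _ ≤ _ := le_rfl

lemma LipschitzWith.intervalIntegrable_deriv_div {f : ℝ → ℂ} {C : ℝ≥0} (hf : LipschitzWith C f)
    {x : ℂ} (hx : ∀ t, f t ≠ x) (a b : ℝ) :
    IntervalIntegrable (fun t => deriv f t / (f t - x)) volume a b := by
  simp only [div_eq_mul_inv]
  refine (hf.intervalIntegrable_deriv a b).mul_continuousOn ?_
  exact ContinuousOn.inv₀ (hf.continuous.sub continuous_const).continuousOn
    fun t _ => sub_ne_zero.2 (hx t)

/-- Two uniformly close Lipschitz curves with the same endpoints have the same logarithmic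
integral. -/
lemma integral_deriv_div_sub_eq_of_close {f g : ℝ → ℂ} (hf : LipschitzWith 1 f)
    (hg : LipschitzWith 1 g) {x : ℂ} {δ B : ℝ} (hδ : 0 < δ) (hgx : ∀ t, δ ≤ ‖g t - x‖)
    (hgB : ∀ t, ‖g t - x‖ ≤ B) (hfg : ∀ t, ‖f t - g t‖ ≤ δ / 2) {a b : ℝ} (ha : f a = g a)
    (hb : f b = g b) :
    ∫ t in a..b, deriv f t / (f t - x) = ∫ t in a..b, deriv g t / (g t - x) := by
  have hg0 : ∀ t, g t - x ≠ 0 := fun t h => by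
    have := hgx t; rw [h, norm_zero] at this; linarith
  have hf0 : ∀ t, f t - x ≠ 0 := fun t h => by
    have h1 := hgx t
    have h2 := hfg t
    have h3 : f t - g t = -(g t - x) := by linear_combination h
    rw [h3, norm_neg] at h2; linarith
  have hfB : ∀ t, ‖f t - x‖ ≤ B + δ / 2 := fun t =>
    calc ‖f t - x‖ = ‖(g t - x) + (f t - g t)‖ := by ring_nf
      _ ≤ _ := (norm_add_le _ _).trans (add_le_add (hgB t) (hfg t))
  have hB : 0 ≤ B := (norm_nonneg _).trans (hgB 0)
  set q : ℝ → ℂ := fun t => (f t - x) / (g t - x) with hq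
  have hqball : ∀ t, q t ∈ Metric.closedBall (1 : ℂ) (1 / 2) := fun t => by
    have h1 : q t - 1 = (f t - g t) / (g t - x) := by
      simp only [hq]; field_simp [hg0 t]; ring
    rw [Metric.mem_closedBall, dist_eq_norm, h1, norm_div, div_le_iff₀ (norm_pos_iff.2 (hg0 t))]
    linarith [hgx t, hfg t]
  have hslit : ∀ z ∈ Metric.closedBall (1 : ℂ) (1 / 2), z ∈ Complex.slitPlane := fun z hz => by
    apply Complex.ball_one_subset_slitPlane
    exact Metric.closedBall_subset_ball (by norm_num) hz
  have hlog : LipschitzOnWith 2 Complex.log (Metric.closedBall (1 : ℂ) (1 / 2)) := by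
    refine (convex_closedBall _ _).lipschitzOnWith_of_nnnorm_hasDerivWithin_le (𝕜 := ℂ)
      (f' := fun z => z⁻¹) (fun z hz => (Complex.hasDerivAt_log (hslit z hz)).hasDerivWithinAt)
      fun z hz => ?_
    rw [← NNReal.coe_le_coe, coe_nnnorm, norm_inv]
    have h1 : (1 : ℝ) / 2 ≤ ‖z‖ := by
      rw [Metric.mem_closedBall, dist_eq_norm] at hz
      have := norm_sub_norm_le (1 : ℂ) (1 - z)
      rw [norm_one, sub_sub_cancel, norm_sub_rev] at this
      linarith
    calc ‖z‖⁻¹ ≤ (1 / 2)⁻¹ := inv_anti₀ (by norm_num) h1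
      _ = _ := by norm_num
  have hqlip : LipschitzWith (Real.toNNReal ((2 * B + δ / 2) / δ ^ 2)) q := by
    refine LipschitzWith.of_dist_le_mul fun s t => ?_
    rw [Real.coe_toNNReal _ (by positivity), dist_eq_norm]
    have h1 : q s - q t = ((f s - f t) * (g t - x) - (f t - x) * (g s - g t)) /
        ((g s - x) * (g t - x)) := by
      simp only [hq]; field_simp [hg0 t, hg0 s]; ring
    have h2 : ‖f s - f t‖ ≤ dist s t := by
      simpa [dist_eq_norm] using hf.dist_le_mul s t
    have h3 : ‖g s - g t‖ ≤ dist s t := by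
      simpa [dist_eq_norm] using hg.dist_le_mul s t
    have h4 : δ ^ 2 ≤ ‖(g s - x) * (g t - x)‖ := by
      rw [norm_mul, sq]; exact mul_le_mul (hgx s) (hgx t) hδ.le (norm_nonneg _)
    rw [h1, norm_div, div_mul_eq_mul_div]
    refine div_le_div₀ (by positivity) ?_ (by positivity) h4
    refine (norm_sub_le _ _).trans ?_
    rw [norm_mul, norm_mul]
    calc _ ≤ dist s t * B + (B + δ / 2) * dist s t := by
          gcongr
          · exact hgB t
          · exact hfB t
      _ = _ := by ring
  have hL := (hlog.comp hqlip.lipschitzOnWith (s := uIcc a b) fun t _ => hqball t)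
  have hif := hf.intervalIntegrable_deriv_div (fun t => sub_ne_zero.1 (hf0 t)) a b
  have hig := hg.intervalIntegrable_deriv_div (fun t => sub_ne_zero.1 (hg0 t)) a b
  have key := hL.integral_eq_sub (hif.sub hig) <| by
    filter_upwards [hf.ae_hasDerivAt, hg.ae_hasDerivAt] with t h1 h2 _
    have h3 := ((h1.sub_const x).div (h2.sub_const x) (hg0 t)).clog_real (hslit _ (hqball t))
    refine h3.congr_deriv ?_
    simp only [Pi.div_apply]
    field_simp [hf0 t, hg0 t]
  rw [intervalIntegral.integral_sub hif hig] at key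
  rw [← sub_eq_zero, key]
  simp [hq, ha, hb, hg0]

/-! ### Rectifiable paths in continua of finite length -/

lemma hausdorffMeasure_image_le_of_locally {C : Set ℂ} (hC : MeasurableSet C) {g : ℂ → ℝ} {ε : ℝ}
    (hε : 0 < ε)
    (hg : ∀ z ∈ C, ∀ w ∈ C, dist z w ≤ ε → dist (g z) (g w) ≤ dist z w) :
    Measure.hausdorffMeasure 1 (g '' C) ≤ Measure.hausdorffMeasure 1 C := by
  let D : ℕ → Set ℂ := disjointed fun n => Metric.ball (TopologicalSpace.denseSeq ℂ n) (ε / 2)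
  have hDm : ∀ n, MeasurableSet (D n) := MeasurableSet.disjointed fun n => measurableSet_ball
  have hDU : ⋃ n, D n = univ := by
    rw [iUnion_disjointed]
    refine eq_univ_of_forall fun z => mem_iUnion.2 ?_
    obtain ⟨n, hn⟩ :=
      (TopologicalSpace.denseRange_denseSeq ℂ).exists_dist_lt z (half_pos hε)
    exact ⟨n, hn⟩
  have hsub : ∀ n, D n ⊆ Metric.ball (TopologicalSpace.denseSeq ℂ n) (ε / 2) :=
    fun n => disjointed_subset _ n
  have hCU : C = ⋃ n, C ∩ D n := by rw [← inter_iUnion, hDU, inter_univ]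
  calc Measure.hausdorffMeasure 1 (g '' C) = Measure.hausdorffMeasure 1 (⋃ n, g '' (C ∩ D n)) := by
        rw [← image_iUnion, ← hCU]
    _ ≤ ∑' n, Measure.hausdorffMeasure 1 (g '' (C ∩ D n)) := measure_iUnion_le _
    _ ≤ ∑' n, Measure.hausdorffMeasure 1 (C ∩ D n) := by
        refine ENNReal.tsum_le_tsum fun n => ?_
        have : LipschitzOnWith 1 g (C ∩ D n) := LipschitzOnWith.of_dist_le_mul fun z hz w hw => by
          rw [NNReal.coe_one, one_mul]
          refine hg z hz.1 w hw.1 ?_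
          have h1 := hsub n hz.2
          have h2 := hsub n hw.2
          rw [Metric.mem_ball] at h1 h2
          linarith [dist_triangle_right z w (TopologicalSpace.denseSeq ℂ n)]
        simpa using this.hausdorffMeasure_image_le zero_le_one
    _ = Measure.hausdorffMeasure 1 (⋃ n, C ∩ D n) := by
        rw [measure_iUnion (fun i j hij => ((disjoint_disjointed _) hij).mono inter_subset_right
          inter_subset_right) fun n => hC.inter (hDm n)]
    _ = Measure.hausdorffMeasure 1 C := by rw [← hCU]

/-- A possibly discontinuous map `β` into `C` which is `1`-Lipschitz up to an additive error `ε`,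
running from `y` at time `0` to `z` at time `l`. For `ε = 0` this is a `1`-Lipschitz path. -/
structure IsCoarsePath (C : Set ℂ) (ε : ℝ) (y z : ℂ) (l : ℝ) (β : ℝ → ℂ) : Prop where
  mem : ∀ t, β t ∈ C
  dist_le : ∀ s t, dist (β s) (β t) ≤ |s - t| + ε
  left : ∀ t ≤ 0, β t = y
  right : ∀ t, l ≤ t → β t = z

namespace IsCoarsePath

variable {C : Set ℂ} {ε : ℝ} {y z : ℂ} {l : ℝ} {β : ℝ → ℂ}

lemma lipschitzWith (h : IsCoarsePath C 0 y z l β) : LipschitzWith 1 β :=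
  LipschitzWith.of_dist_le_mul fun s t => by
    simpa [Real.dist_eq] using h.dist_le s t

lemma mono_length (h : IsCoarsePath C ε y z l β) {l' : ℝ} (hl : l ≤ l') :
    IsCoarsePath C ε y z l' β :=
  { h with right := fun t ht => h.right t (hl.trans ht) }

lemma extend (h : IsCoarsePath C ε y z l β) (hl : 0 ≤ l) {w : ℂ} (hw : w ∈ C)
    (hzw : dist z w ≤ ε) :
    ∃ β', IsCoarsePath C ε y w (l + dist z w) β' := by
  rcases eq_or_ne z w with rfl | hne
  · exact ⟨β, by simpa using h⟩
  have hd : 0 < dist z w := dist_pos.2 hne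
  have key : ∀ s t, s < l + dist z w → l + dist z w ≤ t → dist (β s) w ≤ |s - t| + ε := by
    intro s t hs ht
    rw [abs_of_nonpos (by linarith)]
    rcases le_total l s with h1 | h1
    · rw [h.right s h1]; linarith
    · have h2 := h.dist_le s l
      rw [h.right l le_rfl, abs_of_nonpos (by linarith)] at h2
      linarith [dist_triangle (β s) z w]
  refine ⟨fun t => if t < l + dist z w then β t else w, fun t => ?_, fun s t => ?_, fun t ht => ?_,
    fun t ht => if_neg ht.not_gt⟩
  · split_ifs
    exacts [h.mem t, hw]
  · split_ifs with h1 h2 h2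
    · exact h.dist_le s t
    · exact key s t h1 (not_lt.1 h2)
    · rw [dist_comm, abs_sub_comm]; exact key t s h2 (not_lt.1 h1)
    · rw [dist_self]
      have := dist_nonneg.trans hzw
      positivity
  · rw [if_pos (by linarith), h.left t ht]

/-- Coarse paths with vanishing error subconverge to a `1`-Lipschitz path. -/
lemma exists_limit {K : Set ℂ} (hK : IsCompact K) {ε l : ℕ → ℝ} {y : ℕ → ℂ} {x : ℂ} {l₀ : ℝ}
    {β : ℕ → ℝ → ℂ} (hβ : ∀ n, IsCoarsePath K (ε n) (y n) x (l n) (β n))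
    (hε : Tendsto ε atTop (𝓝 0)) (hl : Tendsto l atTop (𝓝 l₀)) {T : Set ℂ} (hT : IsClosed T)
    (hy : ∀ n, y n ∈ T) :
    ∃ y₀ ∈ T, ∃ α, IsCoarsePath K 0 y₀ x l₀ α := by
  let U : Ultrafilter ℕ := hyperfilter ℕ
  have hU : (U : Filter ℕ) ≤ atTop := by
    rw [← Nat.cofinite_eq_atTop]; exact hyperfilter_le_cofinite
  have hlim : ∀ t, ∃ a ∈ K, Tendsto (fun n => β n t) U (𝓝 a) := fun t => by
    have := hK.ultrafilter_le_nhds (U.map fun n => β n t) <| by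
      rw [Ultrafilter.coe_map]
      exact tendsto_principal.2 (Eventually.of_forall fun n => (hβ n).mem t)
    exact this
  choose α hαK hα using hlim
  have hlip : ∀ s t, dist (α s) (α t) ≤ |s - t| + 0 := fun s t =>
    le_of_tendsto_of_tendsto ((hα s).dist (hα t)) (tendsto_const_nhds.add (hε.mono_left hU))
      (Eventually.of_forall fun n => (hβ n).dist_le s t)
  have hgt : ∀ t, l₀ < t → α t = x := fun t ht => by
    refine tendsto_nhds_unique (hα t) (tendsto_const_nhds.congr' ?_)
    exact hU ((hl.eventually_lt_const ht).mono fun n hn => ((hβ n).right t hn.le).symm)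
  refine ⟨α 0, ?_, α, hαK, hlip, fun t ht => ?_, fun t ht => ?_⟩
  · exact hT.mem_of_tendsto (hα 0)
      (Eventually.of_forall fun n => by rw [(hβ n).left 0 le_rfl]; exact hy n)
  · refine tendsto_nhds_unique (hα t) ((hα 0).congr fun n => ?_)
    rw [(hβ n).left 0 le_rfl, (hβ n).left t ht]
  · rcases ht.eq_or_lt with rfl | ht
    · refine dist_le_zero.1 (le_of_forall_pos_le_add fun η hη => ?_)
      have := hlip l₀ (l₀ + η)
      rw [hgt (l₀ + η) (by linarith)] at this
      simpa [abs_of_pos hη] using this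
    · exact hgt t ht

end IsCoarsePath

lemma exists_isCoarsePath {C : Set ℂ} (hC : IsCompact C) (hconn : IsPreconnected C)
    (hfin : Measure.hausdorffMeasure 1 C ≠ ⊤) {x y : ℂ} (hx : x ∈ C) (hy : y ∈ C) {ε : ℝ} (hε : 0 < ε) :
    ∃ β, IsCoarsePath C ε y x ((Measure.hausdorffMeasure 1 C).toReal + ε) β := by
  let S : ℂ → Set ℝ := fun z => {l | 0 ≤ l ∧ ∃ β, IsCoarsePath C ε y z l β}
  have hS0 : ∀ z, ∀ l ∈ S z, 0 ≤ l := fun z l hl => hl.1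
  have hSb : ∀ z, BddBelow (S z) := fun z => ⟨0, fun l hl => hl.1⟩
  have hSy : 0 ∈ S y := ⟨le_rfl, fun _ => y, fun _ => hy, fun s t => by
    rw [dist_self]; positivity, fun _ _ => rfl, fun _ _ => rfl⟩
  have hstep : ∀ z w, w ∈ C → dist z w ≤ ε → ∀ l ∈ S z, l + dist z w ∈ S w :=
    fun z w hw hzw l hl => ⟨add_nonneg hl.1 dist_nonneg, hl.2.elim fun β h => h.extend hl.1 hw hzw⟩
  have hne : ∀ z ∈ C, (S z).Nonempty := by
    intro z hz
    refine (hconn.induction₂ (fun z w => (S z).Nonempty ↔ (S w).Nonempty) (fun z hz => ?_)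
      (fun _ _ _ _ _ _ h1 h2 => h1.trans h2) (fun _ _ _ _ h => h.symm) hy hz).1 ⟨0, hSy⟩
    filter_upwards [self_mem_nhdsWithin, mem_nhdsWithin_of_mem_nhds (Metric.closedBall_mem_nhds z hε)]
      with w hw hzw
    rw [Metric.mem_closedBall] at hzw
    exact ⟨fun ⟨l, hl⟩ => ⟨_, hstep z w hw (by rwa [dist_comm]) l hl⟩,
      fun ⟨l, hl⟩ => ⟨_, hstep w z hz hzw l hl⟩⟩
  let f : ℂ → ℝ := fun z => sInf (S z)
  have hf1 : ∀ z ∈ C, ∀ w ∈ C, dist z w ≤ ε → f w ≤ f z + dist z w := fun z hz w hw hzw => by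
    rw [← sub_le_iff_le_add]
    refine le_csInf (hne z hz) fun l hl => ?_
    rw [sub_le_iff_le_add]
    exact csInf_le (hSb w) (hstep z w hw hzw l hl)
  have hf : ∀ z ∈ C, ∀ w ∈ C, dist z w ≤ ε → dist (f z) (f w) ≤ dist z w :=
    fun z hz w hw hzw => by
      have h1 := hf1 z hz w hw hzw
      have h2 := hf1 w hw z hz (by rwa [dist_comm])
      rw [dist_comm w z] at h2
      rw [Real.dist_eq, abs_le]; constructor <;> linarith
  have hfc : ContinuousOn f C := by
    refine Metric.continuousOn_iff.2 fun z hz η hη => ⟨min ε η, lt_min hε hη, fun w hw hwz => ?_⟩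
    exact (hf w hw z hz (hwz.le.trans (min_le_left _ _))).trans_lt
      (hwz.trans_le (min_le_right _ _))
  have hfy : f y = 0 := le_antisymm (csInf_le (hSb y) hSy) (Real.sInf_nonneg (hS0 y))
  have hsub : Icc 0 (f x) ⊆ f '' C := by
    rw [← hfy]
    exact (hconn.image f hfc).ordConnected.out (mem_image_of_mem f hy) (mem_image_of_mem f hx)
  have hle : f x ≤ (Measure.hausdorffMeasure 1 C).toReal := by
    have h1 : ENNReal.ofReal (f x) ≤ Measure.hausdorffMeasure 1 C := by
      calc ENNReal.ofReal (f x) = Measure.hausdorffMeasure 1 (Icc 0 (f x)) := by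
            rw [hausdorffMeasure_real, Real.volume_Icc, sub_zero]
        _ ≤ Measure.hausdorffMeasure 1 (f '' C) := measure_mono hsub
        _ ≤ _ := hausdorffMeasure_image_le_of_locally hC.measurableSet hε hf
    exact (ENNReal.ofReal_le_iff_le_toReal hfin).1 h1
  obtain ⟨l, hl, hlt⟩ := exists_lt_of_csInf_lt (hne x hx)
    (show sInf (S x) < (Measure.hausdorffMeasure 1 C).toReal + ε from by
      have : sInf (S x) = f x := rfl
      linarith)
  obtain ⟨β, hβ⟩ := hl.2
  exact ⟨β, hβ.mono_length hlt.le⟩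

/-- Any two points of a continuum of finite length are joined inside it by a path no longer than
the total length of the continuum. -/
lemma exists_path_of_isPreconnected {C : Set ℂ} (hC : IsCompact C) (hconn : IsPreconnected C)
    (hfin : Measure.hausdorffMeasure 1 C ≠ ⊤) {x y : ℂ} (hx : x ∈ C) (hy : y ∈ C) :
    ∃ α, IsCoarsePath C 0 y x (Measure.hausdorffMeasure 1 C).toReal α := by
  choose β hβ using fun n : ℕ =>
    exists_isCoarsePath hC hconn hfin hx hy (ε := 1 / ((n : ℝ) + 1)) (by positivity)
  have h0 : Tendsto (fun n : ℕ => 1 / ((n : ℝ) + 1)) atTop (𝓝 0) :=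
    tendsto_one_div_add_atTop_nhds_zero_nat
  obtain ⟨y₀, hy₀, α, hα⟩ := IsCoarsePath.exists_limit hC hβ h0
    (by simpa using tendsto_const_nhds.add h0) (T := {y}) isClosed_singleton fun _ => rfl
  rw [mem_singleton_iff] at hy₀
  exact ⟨α, hy₀ ▸ hα⟩

/-- A shortest path from a closed subset `T` of a continuum `K` of finite length to a point
`x`: it meets `T` only at its starting point and its length is the measure of its image. -/
lemma exists_shortest_path {K : Set ℂ} (hK : IsCompact K) (hconn : IsPreconnected K)
    (hfin : Measure.hausdorffMeasure 1 K ≠ ⊤) {T : Set ℂ} (hT : IsClosed T) (hTK : T ⊆ K)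
    (hTne : T.Nonempty) {x : ℂ} (hx : x ∈ K) :
    ∃ y ∈ T, ∃ l, 0 ≤ l ∧ ∃ α, IsCoarsePath K 0 y x l α ∧ (∀ t, 0 < t → t ≤ l → α t ∉ T) ∧
      Measure.hausdorffMeasure 1 (α '' Icc 0 l) = ENNReal.ofReal l := by
  let S : Set ℝ := {l | 0 ≤ l ∧ ∃ y ∈ T, ∃ α, IsCoarsePath K 0 y x l α}
  have hSb : BddBelow S := ⟨0, fun l hl => hl.1⟩
  have hSne : S.Nonempty := by
    obtain ⟨y, hy⟩ := hTne
    obtain ⟨α, hα⟩ := exists_path_of_isPreconnected hK hconn hfin hx (hTK hy)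
    exact ⟨_, ENNReal.toReal_nonneg, y, hy, α, hα⟩
  obtain ⟨u, -, hu, huS⟩ := exists_seq_tendsto_sInf hSne hSb
  choose y hy β hβ using fun n => (huS n).2
  obtain ⟨y₀, hy₀, α, hα⟩ := IsCoarsePath.exists_limit hK hβ tendsto_const_nhds hu hT hy
  have hl : 0 ≤ sInf S := Real.sInf_nonneg fun l hl => hl.1
  have hlip := hα.lipschitzWith
  refine ⟨y₀, hy₀, sInf S, hl, α, hα, fun t ht htl htT => ?_, le_antisymm ?_ ?_⟩
  · have : sInf S - t ∈ S := by
      refine ⟨by linarith, α t, htT, fun s => α (max s 0 + t), fun s => hα.mem _, fun s s' => ?_,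
        fun s hs => by simp [max_eq_right hs], fun s hs => hα.right _ ?_⟩
      · refine (hα.dist_le _ _).trans ?_
        rw [add_sub_add_right_eq_sub]
        exact add_le_add_left (abs_max_sub_max_le_abs s s' 0) 0
      · have := le_max_left s 0
        linarith
    have := csInf_le hSb this
    linarith
  · refine (hlip.hausdorffMeasure_image_le zero_le_one _).trans ?_
    rw [hausdorffMeasure_real, Real.volume_Icc]; simp
  · have hsub : α '' Icc 0 (sInf S) ⊆ K := by rintro _ ⟨t, -, rfl⟩; exact hα.mem t
    have hfin' : Measure.hausdorffMeasure 1 (α '' Icc 0 (sInf S)) ≠ ⊤ :=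
      ((measure_mono hsub).trans_lt hfin.lt_top).ne
    obtain ⟨α', hα'⟩ := exists_path_of_isPreconnected (isCompact_Icc.image hlip.continuous)
      (isPreconnected_Icc.image _ hlip.continuous.continuousOn) hfin'
      (x := x) (y := y₀) ⟨_, right_mem_Icc.2 hl, hα.right _ le_rfl⟩
      ⟨_, left_mem_Icc.2 hl, hα.left _ le_rfl⟩
    refine (ENNReal.ofReal_le_iff_le_toReal hfin').2 (csInf_le hSb ?_)
    exact ⟨ENNReal.toReal_nonneg, y₀, hy₀, α', { hα' with mem := fun t => hsub (hα'.mem t) }⟩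

/-! ### Inserting there-and-back excursions -/

lemma LipschitzOnWith.of_inter_Iic_Ici {f : ℝ → ℂ} {S : Set ℝ} {a : ℝ} (ha : a ∈ S)
    (h1 : LipschitzOnWith 1 f (S ∩ Iic a)) (h2 : LipschitzOnWith 1 f (S ∩ Ici a)) :
    LipschitzOnWith 1 f S := by
  have key : ∀ s ∈ S, ∀ t ∈ S, s ≤ t → dist (f s) (f t) ≤ (1 : ℝ≥0) * dist s t := by
    intro s hs t ht hst
    rcases le_total t a with hta | hat
    · exact h1.dist_le_mul s ⟨hs, hst.trans hta⟩ t ⟨ht, hta⟩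
    rcases le_total a s with has | hsa
    · exact h2.dist_le_mul s ⟨hs, has⟩ t ⟨ht, has.trans hst⟩
    have e1 := h1.dist_le_mul s ⟨hs, hsa⟩ a ⟨ha, self_mem_Iic⟩
    have e2 := h2.dist_le_mul a ⟨ha, self_mem_Ici⟩ t ⟨ht, hat⟩
    rw [Real.dist_eq, abs_of_nonpos (by linarith)] at e1 e2 ⊢
    rw [NNReal.coe_one] at *
    linarith [dist_triangle (f s) (f a) (f t)]
  refine LipschitzOnWith.of_dist_le_mul fun s hs t ht => ?_
  rcases le_total s t with h | h
  · exact key s hs t ht h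
  · rw [dist_comm, dist_comm s]; exact key t ht s hs h

/-- A closed `1`-Lipschitz curve of length `L` in `K`, based at `p` and parametrized by `[0, L]`,
which traverses its image twice and has vanishing winding number off `K`. -/
structure IsContour (K : Set ℂ) (p : ℂ) (L : ℝ) (γ : ℝ → ℂ) : Prop where
  nonneg : 0 ≤ L
  lipschitz : LipschitzWith 1 γ
  left : ∀ t ≤ 0, γ t = p
  right : ∀ t, L ≤ t → γ t = p
  mem : ∀ t, γ t ∈ K
  measure_range : Measure.hausdorffMeasure 1 (range γ) = ENNReal.ofReal (L / 2)
  le_variation : ENNReal.ofReal L ≤ eVariationOn γ (Icc 0 L)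
  integral_eq_zero : ∀ x ∉ K, ∀ b, L ≤ b → ∫ t in (0 : ℝ)..b, deriv γ t / (γ t - x) = 0

/-- `δ` arises from `γ` by inserting additional excursions of total length `d`. -/
def IsInsertion (d : ℝ) (γ δ : ℝ → ℂ) : Prop :=
  ∃ ψ : ℝ → ℝ, (∀ a b, a ≤ b → b - a ≤ ψ b - ψ a) ∧ (∀ t, t ≤ ψ t ∧ ψ t ≤ t + d) ∧
    ∀ t, δ (ψ t) = γ t

lemma isContour_const {K : Set ℂ} {p : ℂ} (hp : p ∈ K) : IsContour K p 0 fun _ => p where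
  nonneg := le_rfl
  lipschitz := LipschitzWith.of_dist_le_mul fun s t => by simp
  left _ _ := rfl
  right _ _ := rfl
  mem _ := hp
  measure_range := by
    have := Measure.nullSingletonClass_hausdorff ℂ (d := 1) one_pos
    simp
  le_variation := by simp
  integral_eq_zero x _ b _ := by simp

namespace IsContour

variable {K : Set ℂ} {p : ℂ} {L : ℝ} {γ : ℝ → ℂ}

lemma range_eq (h : IsContour K p L γ) : range γ = γ '' Icc 0 L := by
  refine Subset.antisymm ?_ (image_subset_range _ _)
  rintro _ ⟨t, rfl⟩
  rcases le_total t 0 with h0 | h0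
  · exact ⟨0, left_mem_Icc.2 h.nonneg, by rw [h.left t h0, h.left 0 le_rfl]⟩
  rcases le_total t L with h1 | h1
  · exact ⟨t, ⟨h0, h1⟩, rfl⟩
  · exact ⟨L, right_mem_Icc.2 h.nonneg, by rw [h.right t h1, h.right L le_rfl]⟩

lemma isClosed_range (h : IsContour K p L γ) : IsClosed (range γ) := by
  rw [h.range_eq]
  exact (isCompact_Icc.image h.lipschitz.continuous).isClosed

end IsContour

/-- The curve `γ` with the excursion along `α` and back, of total length `2 * l`, inserted at
time `s`. -/
noncomputable def insertExcursion (γ α : ℝ → ℂ) (s l : ℝ) : ℝ → ℂ := fun t =>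
  if t ≤ s then γ t else if t ≤ s + 2 * l then α (l - |t - s - l|) else γ (t - 2 * l)

section insertExcursion

variable {γ α : ℝ → ℂ} {s l : ℝ}

lemma insertExcursion_of_le {t : ℝ} (ht : t ≤ s) : insertExcursion γ α s l t = γ t := if_pos ht

lemma insertExcursion_of_mem (hl : 0 ≤ l) (hs : γ s = α 0) {t : ℝ}
    (ht : t ∈ Icc s (s + 2 * l)) : insertExcursion γ α s l t = α (l - |t - s - l|) := by
  rcases ht.1.eq_or_lt with rfl | h
  · rw [insertExcursion_of_le le_rfl, hs]; simp [abs_of_nonneg hl]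
  · rw [insertExcursion, if_neg h.not_ge, if_pos ht.2]

lemma insertExcursion_of_ge (hl : 0 ≤ l) (hs : γ s = α 0) {t : ℝ} (ht : s + 2 * l ≤ t) :
    insertExcursion γ α s l t = γ (t - 2 * l) := by
  rcases ht.eq_or_lt with rfl | h
  · rw [insertExcursion_of_mem hl hs ⟨by linarith, le_rfl⟩, add_sub_cancel_right, hs]
    have : s + 2 * l - s - l = l := by ring
    rw [this, abs_of_nonneg hl, sub_self]
  · rw [insertExcursion, if_neg (by linarith), if_neg h.not_ge]

lemma insertExcursion_of_mem_left (hl : 0 ≤ l) (hs : γ s = α 0) {t : ℝ}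
    (ht : t ∈ Icc s (s + l)) : insertExcursion γ α s l t = α (t - s) := by
  rw [insertExcursion_of_mem hl hs ⟨ht.1, by linarith [ht.2]⟩,
    abs_of_nonpos (by linarith [ht.2])]
  congr 1; ring

lemma insertExcursion_of_mem_right (hl : 0 ≤ l) (hs : γ s = α 0) {t : ℝ}
    (ht : t ∈ Icc (s + l) (s + 2 * l)) : insertExcursion γ α s l t = α (s + 2 * l - t) := by
  rw [insertExcursion_of_mem hl hs ⟨by linarith [ht.1], ht.2⟩,
    abs_of_nonneg (by linarith [ht.1])]
  congr 1; ring

lemma insertExcursion_lipschitz (hγ : LipschitzWith 1 γ) (hα : LipschitzWith 1 α) (hl : 0 ≤ l)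
    (hs : γ s = α 0) : LipschitzWith 1 (insertExcursion γ α s l) := by
  have hsub : ∀ a : ℝ, LipschitzWith 1 fun t : ℝ => t - a := fun a =>
    LipschitzWith.of_dist_le_mul fun x y => by simp
  have habs : LipschitzWith 1 fun t : ℝ => l - |t - s - l| :=
    LipschitzWith.of_dist_le_mul fun x y => by
      rw [Real.dist_eq, Real.dist_eq, NNReal.coe_one, one_mul, sub_sub_sub_cancel_left,
        abs_sub_comm x]
      refine (abs_abs_sub_abs_le_abs_sub _ _).trans (le_of_eq ?_)
      congr 1; ring
  have hcongr : ∀ {f g : ℝ → ℂ} {S : Set ℝ}, LipschitzWith 1 g → EqOn f g S →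
      LipschitzOnWith 1 f S := fun hg h x hx y hy => by
    rw [h hx, h hy]; exact hg x y
  rw [← lipschitzOnWith_univ]
  refine LipschitzOnWith.of_inter_Iic_Ici (a := s) (mem_univ _) ?_ ?_
  · rw [univ_inter]
    exact hcongr hγ fun t ht => insertExcursion_of_le ht
  · rw [univ_inter]
    refine LipschitzOnWith.of_inter_Iic_Ici (a := s + 2 * l) (mem_Ici.2 (by linarith)) ?_ ?_
    · exact hcongr (mul_one (1 : ℝ≥0) ▸ hα.comp habs) fun t ht => insertExcursion_of_mem hl hs ht
    · exact hcongr (mul_one (1 : ℝ≥0) ▸ hγ.comp (hsub (2 * l))) fun t ht => insertExcursion_of_ge hl hs ht.2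

lemma range_insertExcursion (hl : 0 ≤ l) (hs : γ s = α 0) :
    range (insertExcursion γ α s l) = range γ ∪ α '' Icc 0 l := by
  refine Subset.antisymm ?_ (union_subset ?_ ?_)
  · rintro _ ⟨t, rfl⟩
    rcases le_total t s with h | h
    · rw [insertExcursion_of_le h]; exact .inl ⟨_, rfl⟩
    rcases le_total t (s + 2 * l) with h' | h'
    · rw [insertExcursion_of_mem hl hs ⟨h, h'⟩]
      refine .inr ⟨_, ⟨?_, ?_⟩, rfl⟩
      · rw [sub_nonneg, abs_le]; constructor <;> linarith
      · linarith [abs_nonneg (t - s - l)]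
    · rw [insertExcursion_of_ge hl hs h']; exact .inl ⟨_, rfl⟩
  · rintro _ ⟨t, rfl⟩
    rcases le_total t s with h | h
    · exact ⟨t, insertExcursion_of_le h⟩
    · exact ⟨t + 2 * l, by rw [insertExcursion_of_ge hl hs (by linarith), add_sub_cancel_right]⟩
  · rintro _ ⟨t, ht, rfl⟩
    exact ⟨t + s, by
      rw [insertExcursion_of_mem_left hl hs ⟨by linarith [ht.1], by linarith [ht.2]⟩,
        add_sub_cancel_right]⟩

lemma eVariationOn_insertExcursion (hl : 0 ≤ l) (hs : γ s = α 0) {L : ℝ} (h0s : 0 ≤ s)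
    (hsL : s ≤ L) :
    eVariationOn (insertExcursion γ α s l) (Icc 0 (L + 2 * l)) =
      eVariationOn γ (Icc 0 L) + 2 * eVariationOn α (Icc 0 l) := by
  have add : ∀ (f : ℝ → ℂ) {a b c : ℝ}, a ≤ b → b ≤ c →
      eVariationOn f (Icc a c) = eVariationOn f (Icc a b) + eVariationOn f (Icc b c) :=
    fun f a b c hab hbc => by
      simpa using (eVariationOn.Icc_add_Icc f hab hbc (mem_univ b)).symm
  rw [add _ h0s (show s ≤ L + 2 * l by linarith),
    add _ (show s ≤ s + l by linarith) (show s + l ≤ L + 2 * l by linarith),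
    add _ (show s + l ≤ s + 2 * l by linarith) (show s + 2 * l ≤ L + 2 * l by linarith),
    add γ h0s hsL]
  have e1 : eVariationOn (insertExcursion γ α s l) (Icc 0 s) = eVariationOn γ (Icc 0 s) :=
    eVariationOn.congr fun t ht => insertExcursion_of_le ht.2
  have e2 : eVariationOn (insertExcursion γ α s l) (Icc s (s + l)) =
      eVariationOn α (Icc 0 l) := by
    rw [eVariationOn.congr (g := α ∘ fun t => t - s)
      fun t ht => insertExcursion_of_mem_left hl hs ht, eVariationOn.comp_eq_of_monotoneOn]
    · simp
    · exact fun a _ b _ hab => sub_le_sub_right hab s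
  have e3 : eVariationOn (insertExcursion γ α s l) (Icc (s + l) (s + 2 * l)) =
      eVariationOn α (Icc 0 l) := by
    rw [eVariationOn.congr (g := α ∘ fun t => s + 2 * l - t)
      fun t ht => insertExcursion_of_mem_right hl hs ht, eVariationOn.comp_eq_of_antitoneOn]
    · rw [image_const_sub_Icc, sub_self, show s + 2 * l - (s + l) = l by ring]
    · exact fun a _ b _ hab => sub_le_sub_left hab _
  have e4 : eVariationOn (insertExcursion γ α s l) (Icc (s + 2 * l) (L + 2 * l)) =
      eVariationOn γ (Icc s L) := by
    rw [eVariationOn.congr (g := γ ∘ fun t => t - 2 * l)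
      fun t ht => insertExcursion_of_ge hl hs ht.1, eVariationOn.comp_eq_of_monotoneOn]
    · simp
    · exact fun a _ b _ hab => sub_le_sub_right hab _
  rw [e1, e2, e3, e4]
  ring

lemma deriv_eq_of_eqOn_Ioo {f g : ℝ → ℂ} {a b t : ℝ} (h : EqOn f g (Ioo a b))
    (ht : t ∈ Ioo a b) : deriv f t = deriv g t :=
  (h.eventuallyEq_of_mem (Ioo_mem_nhds ht.1 ht.2)).deriv_eq

lemma integral_deriv_div_congr {f g : ℝ → ℂ} {a b : ℝ} (hab : a ≤ b) (h : EqOn f g (Ioo a b))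
    (x : ℂ) :
    ∫ t in a..b, deriv f t / (f t - x) = ∫ t in a..b, deriv g t / (g t - x) :=
  intervalIntegral.integral_congr_Ioo_of_le hab fun t ht => by
    simp only [deriv_eq_of_eqOn_Ioo h ht, h ht]

/-- A there-and-back excursion has vanishing logarithmic integral. -/
lemma integral_deriv_div_eq_zero_of_symm {e : ℝ → ℂ} {c : ℝ} (he : ∀ t, e (c - t) = e t)
    (x : ℂ) : ∫ t in (0 : ℝ)..c, deriv e t / (e t - x) = 0 := by
  have hd : ∀ t, deriv e (c - t) = -deriv e t := fun t => by
    have h1 := deriv_comp_const_sub (f := e) (a := c) (x := t)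
    simp only [he] at h1
    rw [h1, neg_neg]
  have h2 := intervalIntegral.integral_comp_sub_left (a := 0) (b := c)
    (fun t => deriv e t / (e t - x)) c
  simp only [hd, he, sub_self, sub_zero, neg_div, intervalIntegral.integral_neg] at h2
  exact self_eq_neg.1 h2.symm

lemma integral_insertExcursion (hγ : LipschitzWith 1 γ) (hα : LipschitzWith 1 α) (hl : 0 ≤ l)
    (hs : γ s = α 0) {x : ℂ} (hγx : ∀ t, γ t ≠ x) (hx : ∀ t, insertExcursion γ α s l t ≠ x)
    {b : ℝ} (h0s : 0 ≤ s) (hsb : s ≤ b) :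
    ∫ t in (0 : ℝ)..b + 2 * l, deriv (insertExcursion γ α s l) t /
      (insertExcursion γ α s l t - x) = ∫ t in (0 : ℝ)..b, deriv γ t / (γ t - x) := by
  have hint := (insertExcursion_lipschitz hγ hα hl hs).intervalIntegrable_deriv_div hx
  have hintγ := hγ.intervalIntegrable_deriv_div hγx
  rw [← intervalIntegral.integral_add_adjacent_intervals (hint 0 s) (hint s _),
    ← intervalIntegral.integral_add_adjacent_intervals (hint s (s + 2 * l)) (hint _ _),
    ← intervalIntegral.integral_add_adjacent_intervals (hintγ 0 s) (hintγ s _)]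
  congr 1
  · exact integral_deriv_div_congr h0s (fun t ht => insertExcursion_of_le ht.2.le) x
  · rw [integral_deriv_div_congr (g := fun t => α (l - |t - s - l|)) (by linarith)
      (fun t ht => insertExcursion_of_mem hl hs (Ioo_subset_Icc_self ht)) x,
      integral_deriv_div_congr (g := fun t => γ (t - 2 * l)) (by linarith)
      (fun t ht => insertExcursion_of_ge hl hs ht.1.le) x]
    have e1 := intervalIntegral.integral_comp_sub_right (a := s + 2 * l) (b := b + 2 * l)
      (fun t => deriv γ t / (γ t - x)) (2 * l)
    have e2 := intervalIntegral.integral_comp_sub_right (a := s) (b := s + 2 * l)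
      (fun t => deriv (fun u => α (l - |u - l|)) t / (α (l - |t - l|) - x)) s
    have d1 : ∀ t, deriv (fun t => γ (t - 2 * l)) t = deriv γ (t - 2 * l) := fun t =>
      deriv_comp_sub_const _ _ _
    have d2 : ∀ t, deriv (fun t => α (l - |t - s - l|)) t =
        deriv (fun u => α (l - |u - l|)) (t - s) := fun t =>
      deriv_comp_sub_const (fun u => α (l - |u - l|)) _ _
    have e3 := integral_deriv_div_eq_zero_of_symm (e := fun u => α (l - |u - l|)) (c := 2 * l)
      (fun t => by
        rw [show 2 * l - t - l = -(t - l) by ring, abs_neg]) x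
    simp only [d1, d2]
    rw [e1, e2]
    simp only [sub_self, add_sub_cancel_left, add_sub_cancel_right]
    rw [e3, zero_add]

end insertExcursion

/-- A contour in a continuum of finite length can be enlarged to pass through a given point. -/
lemma IsContour.exists_insertion {K : Set ℂ} (hK : IsCompact K) (hconn : IsPreconnected K)
    (hfin : Measure.hausdorffMeasure 1 K ≠ ⊤) {p : ℂ} {L : ℝ} {γ : ℝ → ℂ}
    (h : IsContour K p L γ) {x : ℂ} (hx : x ∈ K) :
    ∃ L' δ, IsContour K p L' δ ∧ L ≤ L' ∧ x ∈ range δ ∧ IsInsertion (L' - L) γ δ ∧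
      ∀ t, dist (δ t) (γ t) ≤ L' - L := by
  obtain ⟨y, hy, l, hl, α, hα, hαT, hαm⟩ := exists_shortest_path hK hconn hfin h.isClosed_range
    (range_subset_iff.2 h.mem) (range_nonempty γ) hx
  rw [h.range_eq] at hy
  obtain ⟨s, ⟨h0s, hsL⟩, rfl⟩ := hy
  have hs : γ s = α 0 := (hα.left 0 le_rfl).symm
  have hlip := insertExcursion_lipschitz h.lipschitz hα.lipschitzWith hl hs
  have hrange := range_insertExcursion (γ := γ) hl hs
  have hmem : ∀ t, insertExcursion γ α s l t ∈ K := by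
    rw [← range_subset_iff, hrange]
    exact union_subset (range_subset_iff.2 h.mem) (image_subset_iff.2 fun t _ => hα.mem t)
  have hL := h.nonneg
  refine ⟨L + 2 * l, insertExcursion γ α s l, ⟨by positivity, hlip, fun t ht => ?_,
    fun t ht => ?_, hmem, ?_, ?_, fun z hz b hb => ?_⟩, by linarith, ?_,
    ⟨fun t => if t ≤ s then t else t + 2 * l, fun a b hab => ?_, fun t => ?_, fun t => ?_⟩,
    fun t => ?_⟩
  · rw [insertExcursion_of_le (ht.trans h0s), h.left t ht]
  · rw [insertExcursion_of_ge hl hs (by linarith), h.right _ (by linarith)]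
  · have := Measure.nullSingletonClass_hausdorff ℂ (d := 1) one_pos
    rw [hrange, measure_union₀, h.measure_range, hαm, ← ENNReal.ofReal_add (by positivity) hl]
    · congr 1; ring
    · exact (isCompact_Icc.image hα.lipschitzWith.continuous).measurableSet.nullMeasurableSet
    · refine measure_mono_null (t := {γ s}) ?_ (measure_singleton _)
      rintro _ ⟨hT, t, ht, rfl⟩
      rcases ht.1.eq_or_lt with rfl | ht0
      · exact hs.symm
      · exact absurd hT (hαT t ht0 ht.2)
  · rw [eVariationOn_insertExcursion hl hs h0s hsL, ENNReal.ofReal_add hL (by positivity),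
      ENNReal.ofReal_mul zero_le_two, ENNReal.ofReal_ofNat, ← hαm]
    gcongr
    · exact h.le_variation
    · exact hα.lipschitzWith.hausdorffMeasure_image_Icc_le_eVariationOn hl
  · have hb' : L ≤ b - 2 * l := by linarith
    have := integral_insertExcursion h.lipschitz hα.lipschitzWith hl hs (x := z)
      (fun t ht => hz (by rw [← ht]; exact h.mem t)) (fun t ht => hz (by rw [← ht]; exact hmem t)) h0s (hsL.trans hb')
    rw [sub_add_cancel] at this
    rw [this, h.integral_eq_zero z hz _ hb']
  · rw [hrange]
    exact .inr ⟨l, right_mem_Icc.2 hl, hα.right l le_rfl⟩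
  · dsimp only
    split_ifs <;> linarith
  · dsimp only
    split_ifs <;> constructor <;> linarith
  · dsimp only
    split_ifs with hts
    · exact insertExcursion_of_le hts
    · rw [insertExcursion_of_ge hl hs (by linarith), add_sub_cancel_right]
  · rcases le_total t s with hts | hts
    · rw [insertExcursion_of_le hts, dist_self]; linarith
    · have e := insertExcursion_of_ge hl hs (t := t + 2 * l) (by linarith)
      rw [add_sub_cancel_right] at e
      rw [← e]
      refine (hlip.dist_le_mul _ _).trans (le_of_eq ?_)
      rw [Real.dist_eq, NNReal.coe_one, one_mul, sub_add_cancel_left, abs_neg,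
        abs_of_nonneg (by positivity)]
      ring

/-! ### Exhausting the continuum -/

/-- Contours obtained by successive insertions, passing through every point of the sequence `x`. -/
lemma exists_contour_seq {K : Set ℂ} (hK : IsCompact K) (hconn : IsPreconnected K)
    (hfin : Measure.hausdorffMeasure 1 K ≠ ⊤) {p : ℂ} (hp : p ∈ K) (x : ℕ → K) :
    ∃ (L : ℕ → ℝ) (γ : ℕ → ℝ → ℂ), (∀ n, IsContour K p (L n) (γ n)) ∧ Monotone L ∧
      (∀ n, (x n : ℂ) ∈ range (γ (n + 1))) ∧
      (∀ n, IsInsertion (L (n + 1) - L n) (γ n) (γ (n + 1))) ∧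
      ∀ n t, dist (γ (n + 1) t) (γ n t) ≤ L (n + 1) - L n := by
  let State := {S : ℝ × (ℝ → ℂ) // IsContour K p S.1 S.2}
  have step : ∀ (S : State) (x : K), ∃ S' : State, S.1.1 ≤ S'.1.1 ∧ (x : ℂ) ∈ range S'.1.2 ∧
      IsInsertion (S'.1.1 - S.1.1) S.1.2 S'.1.2 ∧
      ∀ t, dist (S'.1.2 t) (S.1.2 t) ≤ S'.1.1 - S.1.1 := by
    rintro ⟨⟨L, γ⟩, h⟩ ⟨x, hx⟩
    obtain ⟨L', δ, h', h1⟩ := h.exists_insertion hK hconn hfin hx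
    exact ⟨⟨⟨L', δ⟩, h'⟩, h1⟩
  choose next hnext using step
  let S : ℕ → State := fun n =>
    Nat.rec ⟨⟨0, fun _ => p⟩, isContour_const hp⟩ (fun n T => next T (x n)) n
  exact ⟨fun n => (S n).1.1, fun n => (S n).1.2, fun n => (S n).2,
    monotone_nat_of_le_succ fun n => (hnext (S n) (x n)).1, fun n => (hnext (S n) (x n)).2.1,
    fun n => (hnext (S n) (x n)).2.2.1, fun n => (hnext (S n) (x n)).2.2.2⟩

/-- Successive insertions pass to the pointwise limit. -/
lemma isInsertion_limit {L : ℕ → ℝ} {γ : ℕ → ℝ → ℂ} {g : ℝ → ℂ} {l : ℝ}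
    (hlip : ∀ n, LipschitzWith 1 (γ n)) (hL : ∀ n, L n ≤ l)
    (hins : ∀ n, IsInsertion (L (n + 1) - L n) (γ n) (γ (n + 1)))
    (hg : ∀ t, Tendsto (fun n => γ n t) atTop (𝓝 (g t))) (n : ℕ) :
    IsInsertion (l - L n) (γ n) g := by
  choose ψ hexp hle hcomp using hins
  let u : ℕ → ℝ → ℝ := fun k t => Nat.rec t (fun k v => ψ (n + k) v) k
  have hu : ∀ k t, u (k + 1) t = ψ (n + k) (u k t) := fun _ _ => rfl
  have hu1 : ∀ k a b, a ≤ b → b - a ≤ u k b - u k a := fun k a b hab => by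
    induction k with
    | zero => exact le_rfl
    | succ k ih => exact ih.trans (hexp (n + k) _ _ (by linarith))
  have hu2 : ∀ k t, u k t ≤ t + (L (n + k) - L n) := fun k t => by
    induction k with
    | zero => simp [u]
    | succ k ih =>
      have := (hle (n + k) (u k t)).2
      rw [hu, ← add_assoc]; linarith
  have hu3 : ∀ t, Monotone fun k => u k t := fun t =>
    monotone_nat_of_le_succ fun k => (hle (n + k) (u k t)).1
  have hu4 : ∀ k t, γ (n + k) (u k t) = γ n t := fun k t => by
    induction k with
    | zero => rfl
    | succ k ih => rw [hu, ← add_assoc, hcomp, ih]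
  have hub : ∀ k t, u k t ≤ t + (l - L n) := fun k t => (hu2 k t).trans (by linarith [hL (n + k)])
  have hlim : ∀ t, Tendsto (fun k => u k t) atTop (𝓝 (⨆ k, u k t)) := fun t =>
    tendsto_atTop_ciSup (hu3 t) ⟨t + (l - L n), by rintro _ ⟨k, rfl⟩; exact hub k t⟩
  refine ⟨fun t => ⨆ k, u k t, fun a b hab => ?_, fun t => ⟨?_, ?_⟩, fun t => ?_⟩
  · exact ge_of_tendsto' ((hlim b).sub (hlim a)) fun k => hu1 k a b hab
  · exact ge_of_tendsto' (hlim t) fun k => hu3 t (Nat.zero_le k)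
  · exact le_of_tendsto' (hlim t) fun k => hub k t
  · set v := ⨆ k, u k t
    have h1 : Tendsto (fun k => γ (n + k) v) atTop (𝓝 (g v)) :=
      (hg v).comp (tendsto_add_atTop_nat n |>.congr fun k => add_comm k n)
    have h2 : Tendsto (fun k => dist (u k t) v) atTop (𝓝 0) :=
      tendsto_iff_dist_tendsto_zero.1 (hlim t)
    refine tendsto_nhds_unique h1 (tendsto_iff_dist_tendsto_zero.2 ?_)
    refine squeeze_zero (fun _ => dist_nonneg) (fun k => ?_) h2
    rw [← hu4 k t, dist_comm (u k t)]
    simpa using (hlip (n + k)).dist_le_mul v (u k t)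

lemma IsInsertion.eVariationOn_le {γ δ : ℝ → ℂ} {L l : ℝ} (h : IsInsertion (l - L) γ δ) :
    eVariationOn γ (Icc 0 L) ≤ eVariationOn δ (Icc 0 l) := by
  obtain ⟨ψ, hexp, hle, hcomp⟩ := h
  rw [← eVariationOn.congr (f := δ ∘ ψ) fun t _ => hcomp t]
  refine eVariationOn.comp_le_of_monotoneOn _ _ (fun a _ b _ hab => ?_) fun t ht => ?_
  · linarith [hexp a b hab]
  · exact ⟨ht.1.trans (hle t).1, by linarith [ht.2, (hle t).2]⟩

lemma IsInsertion.range_subset {γ δ : ℝ → ℂ} {d : ℝ} (h : IsInsertion d γ δ) :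
    range γ ⊆ range δ := by
  obtain ⟨ψ, -, -, hcomp⟩ := h
  rintro _ ⟨t, rfl⟩
  exact ⟨ψ t, hcomp t⟩

/-- The new points reached by an insertion form a set of measure at most its length. -/
lemma IsInsertion.hausdorffMeasure_le {γ δ : ℝ → ℂ} {L l : ℝ} (h : IsInsertion (l - L) γ δ)
    (hL : 0 ≤ L) (hδ : LipschitzWith 1 δ) (hγ : IsClosed (range γ)) :
    Measure.hausdorffMeasure 1 (δ '' Icc 0 l) ≤
      Measure.hausdorffMeasure 1 (range γ) + ENNReal.ofReal (l - L) := by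
  obtain ⟨ψ, hexp, hle, hcomp⟩ := h
  have hLl : L ≤ l := by linarith [(hle 0).1, (hle 0).2]
  set A := Icc 0 l ∩ δ ⁻¹' range γ with hA
  have hAm : MeasurableSet A := measurableSet_Icc.inter (hγ.preimage hδ.continuous).measurableSet
  have hanti : AntilipschitzWith 1 ψ := AntilipschitzWith.of_le_mul_dist fun a b => by
    rw [NNReal.coe_one, one_mul, Real.dist_eq, Real.dist_eq]
    rcases le_total a b with hab | hab
    · have := hexp a b hab
      rw [abs_sub_comm, abs_sub_comm (ψ a), abs_of_nonneg (by linarith),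
        abs_of_nonneg (by linarith)]
      exact this
    · have := hexp b a hab
      rw [abs_of_nonneg (by linarith), abs_of_nonneg (by linarith)]
      exact this
  have hsub : ψ '' Icc 0 L ⊆ A := by
    rintro _ ⟨t, ht, rfl⟩
    exact ⟨⟨ht.1.trans (hle t).1, by linarith [ht.2, (hle t).2]⟩, ⟨t, (hcomp t).symm⟩⟩
  have hvA : ENNReal.ofReal L ≤ volume A := by
    calc ENNReal.ofReal L = Measure.hausdorffMeasure 1 (Icc 0 L) := by
          rw [hausdorffMeasure_real, Real.volume_Icc, sub_zero]
      _ ≤ Measure.hausdorffMeasure 1 (ψ '' Icc 0 L) := by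
          simpa using hanti.le_hausdorffMeasure_image zero_le_one (Icc 0 L)
      _ ≤ Measure.hausdorffMeasure 1 A := measure_mono hsub
      _ = volume A := by rw [hausdorffMeasure_real]
  have hdiff : volume (Icc 0 l \ A) ≤ ENNReal.ofReal (l - L) := by
    rw [measure_sdiff inter_subset_left hAm.nullMeasurableSet
      ((measure_mono inter_subset_left).trans_lt measure_Icc_lt_top).ne, Real.volume_Icc, sub_zero,
      ENNReal.ofReal_sub _ hL]
    gcongr
  calc Measure.hausdorffMeasure 1 (δ '' Icc 0 l)
      ≤ Measure.hausdorffMeasure 1 (range γ ∪ δ '' (Icc 0 l \ A)) := by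
        refine measure_mono ?_
        rintro _ ⟨t, ht, rfl⟩
        by_cases hr : δ t ∈ range γ
        · exact .inl hr
        · exact .inr ⟨t, ⟨ht, fun h => hr h.2⟩, rfl⟩
    _ ≤ _ := measure_union_le _ _
    _ ≤ _ := by
        gcongr
        refine (hδ.hausdorffMeasure_image_le zero_le_one _).trans ?_
        rw [hausdorffMeasure_real]
        simpa using hdiff

/-- A continuum of finite length is the image of a closed `1`-Lipschitz curve on `[0, l]` of length
`l = 2 * H¹(K)` with vanishing winding number off `K`. -/
lemma exists_closed_curve {K : Set ℂ} (hK : IsCompact K) (hconn : IsConnected K)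
    (hfin : Measure.hausdorffMeasure 1 K ≠ ⊤) :
    ∃ (p : ℂ) (l : ℝ) (g : ℝ → ℂ), 0 ≤ l ∧ LipschitzWith 1 g ∧ (∀ t ≤ 0, g t = p) ∧
      (∀ t, l ≤ t → g t = p) ∧ range g = K ∧
      ENNReal.ofReal l = 2 * Measure.hausdorffMeasure 1 K ∧
      ENNReal.ofReal l ≤ eVariationOn g (Icc 0 l) ∧
      ∀ x ∉ K, ∀ b, l ≤ b → ∫ t in (0 : ℝ)..b, deriv g t / (g t - x) = 0 := by
  obtain ⟨p, hp⟩ := hconn.nonempty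
  have : Nonempty K := ⟨⟨p, hp⟩⟩
  obtain ⟨L, γ, hγ, hmono, hx, hins, hdist⟩ := exists_contour_seq hK hconn.isPreconnected hfin hp
    (TopologicalSpace.denseSeq K)
  have hLK : ∀ n, ENNReal.ofReal (L n / 2) ≤ Measure.hausdorffMeasure 1 K := fun n => by
    rw [← (hγ n).measure_range]
    exact measure_mono (range_subset_iff.2 (hγ n).mem)
  have hbdd : BddAbove (range L) := by
    refine ⟨2 * (Measure.hausdorffMeasure 1 K).toReal, ?_⟩
    rintro _ ⟨n, rfl⟩
    have := (ENNReal.ofReal_le_iff_le_toReal hfin).1 (hLK n)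
    linarith
  set l := ⨆ n, L n with hl
  have hlim : Tendsto L atTop (𝓝 l) := tendsto_atTop_ciSup hmono hbdd
  have hLl : ∀ n, L n ≤ l := le_ciSup hbdd
  have hl0 : 0 ≤ l := (hγ 0).nonneg.trans (hLl 0)
  have hlim0 : Tendsto (fun n => l - L n) atTop (𝓝 0) := by
    simpa using (tendsto_const_nhds (x := l)).sub hlim
  have hdist' : ∀ n m, n ≤ m → ∀ t, dist (γ n t) (γ m t) ≤ L m - L n := fun n m hnm t => by
    induction m, hnm using Nat.le_induction with
    | base => simp
    | succ m _ ih =>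
      have := hdist m t
      rw [dist_comm] at this
      linarith [dist_triangle (γ n t) (γ m t) (γ (m + 1) t)]
  have hcauchy : ∀ t, CauchySeq fun n => γ n t := fun t => by
    refine cauchySeq_of_le_tendsto_0' (fun n => l - L n) (fun n m hnm => ?_) hlim0
    linarith [hdist' n m hnm t, hLl m]
  choose g hg using fun t => cauchySeq_tendsto_of_complete (hcauchy t)
  have hgdist : ∀ n t, dist (γ n t) (g t) ≤ l - L n := fun n t => by
    refine le_of_tendsto_of_tendsto (tendsto_const_nhds.dist (hg t)) (hlim.sub_const (L n)) ?_
    exact (eventually_ge_atTop n).mono fun m hm => hdist' n m hm t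
  have hglip : LipschitzWith 1 g := LipschitzWith.of_dist_le_mul fun s t =>
    le_of_tendsto' ((hg s).dist (hg t)) fun n => (hγ n).lipschitz.dist_le_mul s t
  have hgl : ∀ t ≤ 0, g t = p := fun t ht =>
    tendsto_nhds_unique (hg t) (tendsto_const_nhds.congr fun n => ((hγ n).left t ht).symm)
  have hgr : ∀ t, l ≤ t → g t = p := fun t ht =>
    tendsto_nhds_unique (hg t)
      (tendsto_const_nhds.congr fun n => ((hγ n).right t ((hLl n).trans ht)).symm)
  have hinsg : ∀ n, IsInsertion (l - L n) (γ n) g :=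
    isInsertion_limit (fun n => (hγ n).lipschitz) hLl hins hg
  have hgrange : range g = g '' Icc 0 l := by
    refine Subset.antisymm ?_ (image_subset_range _ _)
    rintro _ ⟨t, rfl⟩
    rcases le_total t 0 with h0 | h0
    · exact ⟨0, left_mem_Icc.2 hl0, by rw [hgl t h0, hgl 0 le_rfl]⟩
    rcases le_total t l with h1 | h1
    · exact ⟨t, ⟨h0, h1⟩, rfl⟩
    · exact ⟨l, right_mem_Icc.2 hl0, by rw [hgr t h1, hgr l le_rfl]⟩
  have hgclosed : IsClosed (range g) := by
    rw [hgrange]; exact (isCompact_Icc.image hglip.continuous).isClosed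
  have hgK : range g = K := by
    refine Subset.antisymm ?_ fun z hz => ?_
    · rintro _ ⟨t, rfl⟩
      exact hK.isClosed.mem_of_tendsto (hg t) (Eventually.of_forall fun n => (hγ n).mem t)
    · have hcl : IsClosed (((↑) : K → ℂ) ⁻¹' range g) := hgclosed.preimage continuous_subtype_val
      have hsub : range (TopologicalSpace.denseSeq K) ⊆ ((↑) : K → ℂ) ⁻¹' range g := by
        rintro _ ⟨n, rfl⟩
        exact (hinsg (n + 1)).range_subset (hx n)
      exact closure_minimal hsub hcl (TopologicalSpace.denseRange_denseSeq K ⟨z, hz⟩)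
  have hle : ENNReal.ofReal (l / 2) ≤ Measure.hausdorffMeasure 1 K :=
    le_of_tendsto' (ENNReal.tendsto_ofReal (hlim.div_const 2)) hLK
  have hge : Measure.hausdorffMeasure 1 K ≤ ENNReal.ofReal (l / 2) := by
    have h1 : Tendsto (fun n => ENNReal.ofReal (L n / 2) + ENNReal.ofReal (l - L n)) atTop
        (𝓝 (ENNReal.ofReal (l / 2))) := by
      simpa using (ENNReal.tendsto_ofReal (hlim.div_const 2)).add (ENNReal.tendsto_ofReal hlim0)
    refine ge_of_tendsto' h1 fun n => ?_
    have := (hinsg n).hausdorffMeasure_le (hγ n).nonneg hglip (hγ n).isClosed_range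
    rwa [← hgrange, hgK, (hγ n).measure_range] at this
  refine ⟨p, l, g, hl0, hglip, hgl, hgr, hgK, ?_, ?_, fun x hxK b hb => ?_⟩
  · rw [← le_antisymm hle hge, ← ENNReal.ofReal_ofNat 2, ← ENNReal.ofReal_mul zero_le_two]
    congr 1; ring
  · exact le_of_tendsto' (ENNReal.tendsto_ofReal hlim) fun n =>
      (hγ n).le_variation.trans (hinsg n).eVariationOn_le
  · obtain ⟨δ, hδ, hδx⟩ : ∃ δ > 0, ∀ z ∈ K, δ ≤ ‖z - x‖ := by
      obtain ⟨δ, hδ, hball⟩ := Metric.isOpen_iff.1 hK.isClosed.isOpen_compl x hxK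
      refine ⟨δ, hδ, fun z hz => not_lt.1 fun hlt => hball ?_ hz⟩
      rwa [Metric.mem_ball, dist_eq_norm]
    obtain ⟨B, hB⟩ := (hK.image (f := fun z => z - x) (by fun_prop)).isBounded.exists_norm_le
    have hgmem : ∀ t, g t ∈ K := fun t => hgK ▸ mem_range_self t
    obtain ⟨n, hn⟩ := (hlim0.eventually_le_const (half_pos hδ)).exists
    rw [← (hγ n).integral_eq_zero x hxK b ((hLl n).trans hb)]
    refine (integral_deriv_div_sub_eq_of_close (hγ n).lipschitz hglip hδ
      (fun t => hδx _ (hgmem t)) (fun t => hB _ (mem_image_of_mem _ (hgmem t))) (fun t => ?_)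
      ?_ ?_).symm
    · rw [← dist_eq_norm]; exact (hgdist n t).trans hn
    · rw [(hγ n).left 0 le_rfl, hgl 0 le_rfl]
    · rw [(hγ n).right b ((hLl n).trans hb), hgr b hb]

/-! ### Periodic parametrization -/

lemma lipschitzWith_comp_mul_fract {g : ℝ → ℂ} (hg : LipschitzWith 1 g) {M : ℝ≥0}
    (h01 : g 0 = g M) : LipschitzWith M fun t => g (M * Int.fract t) := by
  have h : ∀ a b : ℝ, dist (g (M * a)) (g (M * b)) ≤ M * |a - b| := fun a b => by
    refine (hg.dist_le_mul _ _).trans (le_of_eq ?_)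
    rw [Real.dist_eq, ← mul_sub, abs_mul, NNReal.abs_eq, NNReal.coe_one, one_mul]
  have key : ∀ s t : ℝ, s ≤ t →
      dist (g (M * Int.fract s)) (g (M * Int.fract t)) ≤ M * dist s t := fun s t hst => by
    have es := Int.floor_add_fract s
    have et := Int.floor_add_fract t
    rcases (Int.floor_mono hst).eq_or_lt with hfl | hfl
    · refine (h _ _).trans (le_of_eq ?_)
      rw [Real.dist_eq]
      congr 2
      rw [hfl] at es
      linarith
    · have hfl' : (⌊s⌋ : ℝ) + 1 ≤ ⌊t⌋ := by exact_mod_cast hfl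
      have h1 := h (Int.fract s) 1
      have h2 := h 0 (Int.fract t)
      have hs1 := (Int.fract_lt_one s).le
      have ht0 := Int.fract_nonneg t
      rw [mul_one, abs_of_nonpos (by linarith)] at h1
      rw [mul_zero, h01, abs_of_nonpos (by linarith)] at h2
      rw [Real.dist_eq, abs_of_nonpos (by linarith)]
      calc _ ≤ _ := dist_triangle _ (g M) _
        _ ≤ _ := add_le_add h1 h2
        _ = M * ((1 - Int.fract s) + Int.fract t) := by ring
        _ ≤ M * (-(s - t)) := by
          gcongr
          linarith
  refine LipschitzWith.of_dist_le_mul fun s t => ?_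
  rcases le_total s t with hst | hst
  · exact key s t hst
  · rw [dist_comm, dist_comm s]; exact key t s hst

/-- every (nonempty) compact connected set K ⊂ ℝ² with H¹(K) < ∞ is the
image of a Lipschitz closed curve with zero winding number off K and length 2·H¹(K). -/
theorem stmt_15 (K : Set ℂ) (hK : IsCompact K) (hconn : IsConnected K)
    (hfin : (MeasureTheory.Measure.hausdorffMeasure 1 : MeasureTheory.Measure ℂ) K ≠ ⊤) :
    ∃ γ : ℝ → ℂ, Function.Periodic γ 1 ∧ (∃ L : NNReal, LipschitzWith L γ) ∧
      Set.range γ = K ∧ (∀ x ∉ K, winding γ x = 0) ∧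
      ENNReal.ofReal (∫ t in (0:ℝ)..1, ‖deriv γ t‖) =
        2 * (MeasureTheory.Measure.hausdorffMeasure 1 : MeasureTheory.Measure ℂ) K := by
  obtain ⟨p, l, g, hl, hg, hgl, hgr, hgK, hlK, hvar, hwind⟩ := exists_closed_curve hK hconn hfin
  obtain ⟨M, hM⟩ : ∃ M : ℝ≥0, (M : ℝ) = l + 1 := ⟨⟨l + 1, by positivity⟩, rfl⟩
  have hM0 : (0 : ℝ) < M := by rw [hM]; positivity
  have hlM : l ≤ M := by linarith
  have hγ : ∀ t ∈ Ioo (0 : ℝ) 1, g (M * Int.fract t) = g (M * t) := fun t ht => by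
    rw [Int.fract_eq_self.2 ⟨ht.1.le, ht.2⟩]
  have hderiv : ∀ t ∈ Ioo (0 : ℝ) 1,
      deriv (fun t => g (M * Int.fract t)) t = M * deriv g (M * t) := fun t ht => by
    have h1 := deriv_eq_of_eqOn_Ioo (f := fun t => g (M * Int.fract t)) (g := fun t => g (M * t))
      hγ ht
    rw [h1, deriv_comp_mul_left, Complex.real_smul]
  refine ⟨fun t => g (M * Int.fract t), fun t => by simp only [Int.fract_add_one],
    ⟨M, lipschitzWith_comp_mul_fract hg (by rw [hgl 0 le_rfl, hgr M hlM])⟩, ?_, fun x hx => ?_, ?_⟩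
  · refine Subset.antisymm ?_ ?_
    · rw [← hgK]
      rintro _ ⟨t, rfl⟩
      exact mem_range_self _
    · rw [← hgK]
      rintro _ ⟨t, rfl⟩
      rcases le_total t 0 with h0 | h0
      · exact ⟨0, by simp [hgl t h0, hgl 0 le_rfl]⟩
      rcases lt_or_ge t M with h1 | h1
      · refine ⟨t / M, ?_⟩
        have : Int.fract (t / M) = t / M :=
          Int.fract_eq_self.2 ⟨by positivity, (div_lt_one hM0).2 h1⟩
        simp only [this]
        rw [mul_div_cancel₀ _ hM0.ne']
      · exact ⟨0, by simp [hgr t (hlM.trans h1), hgl 0 le_rfl]⟩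
  · have e1 : ∫ t in (0 : ℝ)..1, deriv (fun t => g (M * Int.fract t)) t /
        (g (M * Int.fract t) - x) =
        ∫ t in (0 : ℝ)..1, (M : ℂ) * (deriv g (M * t) / (g (M * t) - x)) :=
      intervalIntegral.integral_congr_Ioo_of_le zero_le_one fun t ht => by
        simp only [hderiv t ht, hγ t ht, mul_div_assoc]
    have e2 := intervalIntegral.integral_comp_mul_left (a := 0) (b := 1)
      (fun t => deriv g t / (g t - x)) hM0.ne'
    rw [mul_zero, mul_one, hwind x hx M hlM, smul_zero] at e2
    rw [winding, e1, intervalIntegral.integral_const_mul, e2, mul_zero, mul_zero]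
  · have e1 : ∫ t in (0 : ℝ)..1, ‖deriv (fun t => g (M * Int.fract t)) t‖ =
        ∫ t in (0 : ℝ)..1, (M : ℝ) * ‖deriv g (M * t)‖ :=
      intervalIntegral.integral_congr_Ioo_of_le zero_le_one fun t ht => by
        simp only [hderiv t ht, norm_mul, Complex.norm_real, Real.norm_eq_abs, NNReal.abs_eq]
    have e2 := intervalIntegral.integral_comp_mul_left (a := 0) (b := 1)
      (fun t => ‖deriv g t‖) hM0.ne'
    rw [mul_zero, mul_one, smul_eq_mul] at e2
    have hint : ∀ c d, IntervalIntegrable (fun t => ‖deriv g t‖) volume c d := fun c d =>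
      (hg.intervalIntegrable_deriv c d).norm
    have e3 : ∫ t in l..(M : ℝ), ‖deriv g t‖ = 0 := by
      rw [intervalIntegral.integral_congr_Ioo_of_le (g := fun _ => 0) hlM,
        intervalIntegral.integral_zero]
      intro t ht
      have := deriv_eq_of_eqOn_Ioo (f := g) (g := fun _ => p) (fun u hu => hgr u hu.1.le) ht
      simp [this]
    have e4 := intervalIntegral.integral_add_adjacent_intervals (hint 0 l) (hint l M)
    rw [e3, add_zero] at e4
    rw [e1, intervalIntegral.integral_const_mul, e2, mul_inv_cancel_left₀ hM0.ne', ← e4, ← hlK]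
    refine le_antisymm (ENNReal.ofReal_le_ofReal ?_)
      (hvar.trans (hg.eVariationOn_Icc_le_integral 0 l))
    calc ∫ t in (0 : ℝ)..l, ‖deriv g t‖ ≤ ∫ _ in (0 : ℝ)..l, (1 : ℝ) := by
          refine intervalIntegral.integral_mono hl (hint 0 l) intervalIntegrable_const fun t => ?_
          simpa using norm_deriv_le_of_lipschitz (𝕜 := ℝ) hg (x₀ := t)
      _ = l := by simp
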